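/- Let x₀, x₁ be linearly independent positive light-like vectors in R³ and y a unit space-like vector with x₀∘y < 0, x₁∘y < 0. Set u₀ = (1/2)(1 + 1/(x₀∘y)²)·x₀ + (−1/(x₀∘y))·y and u₀' = (1/2)·x₀ + (−1/(x₀∘x₁))·x₁. Then both u₀ and u₀' lie on the horosphere determined by x₀, and √(−2(1 + u₀∘u₀')) = √(1/(x₀∘y)² − 2(x₁∘y)/((x₀∘x₁)(x₀∘y))). -/

import Mathlib

/-- The Lorentzian inner product on `ℝ³`. -/
def lprod (x y : Fin 3 → ℝ) : ℝ := -(x 0 * y 0) + x 1 * y 1 + x 2 * y 2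

theorem lprod_comb (a b c d : ℝ) (x y z w : Fin 3 → ℝ) :
    lprod (a • x + b • y) (c • z + d • w) =
      a * c * lprod x z + a * d * lprod x w + b * c * lprod y z + b * d * lprod y w := by
  simp only [lprod, Pi.add_apply, Pi.smul_apply, smul_eq_mul]
  ring

theorem lprod_comb_left (a b : ℝ) (x y z : Fin 3 → ℝ) :
    lprod (a • x + b • y) z = a * lprod x z + b * lprod y z := by
  simp only [lprod, Pi.add_apply, Pi.smul_apply, smul_eq_mul]
  ring

theorem lprod_symm (x y : Fin 3 → ℝ) : lprod x y = lprod y x := by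
  simp only [lprod]
  ring

theorem pos_of_horosphere {u x : Fin 3 → ℝ} (hx : lprod x x = 0) (hpos : 0 < x 0)
    (hu : lprod u u = -1) (hux : lprod u x = -1) : 0 < u 0 := by
  simp only [lprod] at *
  by_contra hn
  have h0 : 0 ≤ -u 0 * x 0 := mul_nonneg (by linarith) hpos.le
  have e : u 1 * x 1 + u 2 * x 2 = -1 + u 0 * x 0 := by linarith
  have cs : (u 1 * x 1 + u 2 * x 2) ^ 2 + (u 1 * x 2 - u 2 * x 1) ^ 2
      = (u 0 * u 0 - 1) * (x 0 * x 0) := by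
    have e1 : u 0 * u 0 - 1 = u 1 * u 1 + u 2 * u 2 := by linarith
    have e2 : x 0 * x 0 = x 1 * x 1 + x 2 * x 2 := by linarith
    rw [e1, e2]
    ring
  rw [e] at cs
  nlinarith [sq_nonneg (u 1 * x 2 - u 2 * x 1), mul_pos hpos hpos]

theorem lprod_ne_zero_of_indep {x z : Fin 3 → ℝ} (hind : LinearIndependent ℝ ![x, z])
    (hx : lprod x x = 0) (hz : lprod z z = 0) (hpos : 0 < z 0) : lprod x z ≠ 0 := by
  intro hb
  rw [LinearIndependent.pair_iff] at hind
  have key : (z 0 * x 1 - x 0 * z 1) ^ 2 + (z 0 * x 2 - x 0 * z 2) ^ 2 = 0 := by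
    simp only [lprod] at *
    linear_combination (z 0) ^ 2 * hx + (x 0) ^ 2 * hz - 2 * x 0 * z 0 * hb
  have k1 : z 0 * x 1 - x 0 * z 1 = 0 := by
    nlinarith [sq_nonneg (z 0 * x 1 - x 0 * z 1), sq_nonneg (z 0 * x 2 - x 0 * z 2)]
  have k2 : z 0 * x 2 - x 0 * z 2 = 0 := by
    nlinarith [sq_nonneg (z 0 * x 1 - x 0 * z 1), sq_nonneg (z 0 * x 2 - x 0 * z 2)]
  have := (hind (z 0) (-x 0) (by
    ext i
    fin_cases i
    · simp
      ring
    · simp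
      linarith
    · simp
      linarith)).1
  linarith

/-- The two points where the edges of the ideal quadrilateral meet the
horosphere determined by `x₀`, and the horocyclic distance between them. -/
theorem horocyclic_arc_of_quadrilateral {x₀ x₁ y : Fin 3 → ℝ}
    (hind : LinearIndependent ℝ ![x₀, x₁])
    (h₀ : lprod x₀ x₀ = 0) (h₀pos : 0 < x₀ 0)
    (h₁ : lprod x₁ x₁ = 0) (h₁pos : 0 < x₁ 0)
    (hy : lprod y y = 1) (hy₀ : lprod x₀ y < 0) (hy₁ : lprod x₁ y < 0)
    (u₀ u₀' : Fin 3 → ℝ)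
    (hu₀ : u₀ = ((1 + 1 / (lprod x₀ y) ^ 2) / 2) • x₀ + (-1 / lprod x₀ y) • y)
    (hu₀' : u₀' = (1 / 2 : ℝ) • x₀ + (-1 / lprod x₀ x₁) • x₁) :
    (lprod u₀ u₀ = -1 ∧ 0 < u₀ 0 ∧ lprod u₀ x₀ = -1) ∧
    (lprod u₀' u₀' = -1 ∧ 0 < u₀' 0 ∧ lprod u₀' x₀ = -1) ∧
    Real.sqrt (-2 * (1 + lprod u₀ u₀')) =
      Real.sqrt (1 / (lprod x₀ y) ^ 2 -
        2 * lprod x₁ y / (lprod x₀ x₁ * lprod x₀ y)) := by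
  have hb := lprod_ne_zero_of_indep hind h₀ h₁ h₁pos
  have ha := hy₀.ne
  have A : lprod u₀ u₀ = -1 := by
    rw [hu₀, lprod_comb, h₀, hy, lprod_symm y x₀]
    field_simp
    ring
  have B : lprod u₀ x₀ = -1 := by
    rw [hu₀, lprod_comb_left, h₀, lprod_symm y x₀]
    field_simp
    ring
  have C : lprod u₀' u₀' = -1 := by
    rw [hu₀', lprod_comb, h₀, h₁, lprod_symm x₁ x₀]
    field_simp
    ring
  have D : lprod u₀' x₀ = -1 := by
    rw [hu₀', lprod_comb_left, h₀, lprod_symm x₁ x₀]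
    field_simp
    ring
  refine ⟨⟨A, pos_of_horosphere h₀ h₀pos A B, B⟩, ⟨C, pos_of_horosphere h₀ h₀pos C D, D⟩, ?_⟩
  congr 1
  rw [hu₀, hu₀', lprod_comb, h₀, lprod_symm y x₀, lprod_symm y x₁]
  field_simp
  ring
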